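/- Let k ≥ 2 be an integer and let Γ be a k-free group. Let r be an integer with 1 ≤ r ≤ k−1, let A be a subgroup of Γ of rank r, and let x ∈ Γ be an element such that the subgroup ⟨A, x⟩ generated by A and x has rank r+1. Then ⟨A, x⟩ is the internal free product of A and the cyclic subgroup ⟨x⟩; equivalently, if u_1, …, u_r is a free basis of A (A is free of rank r since Γ is k-free), then u_1, …, u_r, x is a free basis of the free group ⟨A, x⟩. -/

import Mathlib

open Set

/-- The rank of a subgroup `H` of `G`: the minimal cardinality (in `ℕ∞`) of a subset of `G`
generating `H`. -/
noncomputable def grpRank {G : Type*} [Group G] (H : Subgroup G) : ℕ∞ :=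
  ⨅ S ∈ {S : Set G | Subgroup.closure S = H}, S.encard

/-- A group is `k`-free if every subgroup of rank at most `k` is free. -/
def KFree (Γ : Type*) [Group Γ] (k : ℕ) : Prop :=
  ∀ H : Subgroup Γ, grpRank H ≤ (k : ℕ∞) → IsFreeGroup H

/-- Every nontrivial element of a free group acts nontrivially in some action of the free group on
a finite set. -/
theorem FreeGroup.exists_lift_perm_ne_one {α : Type*} {g : FreeGroup α} (hg : g ≠ 1) :
    ∃ (n : ℕ) (σ : α → Equiv.Perm (Fin n)), FreeGroup.lift σ g ≠ 1 := by
  classical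
  set L := g.toWord with hL
  set n := L.length with hn
  have hpos : 0 < n := by
    rw [hn, List.length_pos_iff, hL]
    simpa using hg
  have hred : ∀ i (h : i + 1 < L.length), L[i].1 = L[i + 1].1 → L[i].2 = L[i + 1].2 := by
    have := FreeGroup.isReduced_toWord (x := g)
    rw [FreeGroup.IsReduced, List.isChain_iff_getElem] at this
    exact this
  -- The `i`-th letter of the word should move `i + 1` to `i`.
  have key : ∀ a : α, ∃ σ : Equiv.Perm (Fin (n + 1)), ∀ i (h : i < L.length),
      (L[i] = (a, true) → σ ⟨i + 1, by omega⟩ = ⟨i, by omega⟩) ∧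
      (L[i] = (a, false) → σ ⟨i, by omega⟩ = ⟨i + 1, by omega⟩) := by
    intro a
    let P : Fin (n + 1) → Prop := fun j ↦ ∃ (i : ℕ) (h : i < L.length), j = i + 1 ∧ L[i] = (a, true)
    let Q : Fin (n + 1) → Prop := fun j ↦ ∃ h : j < L.length, L[j] = (a, false)
    let f : Fin (n + 1) → Fin (n + 1) := fun j ↦
      if P j then ⟨j - 1, by omega⟩ else if h : Q j then ⟨j + 1, by have := h.1; omega⟩ else j
    have hP : ∀ i (h : i < L.length), L[i] = (a, true) →
        P ⟨i + 1, by omega⟩ ∧ f ⟨i + 1, by omega⟩ = ⟨i, by omega⟩ := by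
      intro i h hi
      have hp : P ⟨i + 1, by omega⟩ := ⟨i, h, rfl, hi⟩
      exact ⟨hp, by simp [f, hp]⟩
    have hQ : ∀ i (h : i < L.length), L[i] = (a, false) →
        Q ⟨i, by omega⟩ ∧ f ⟨i, by omega⟩ = ⟨i + 1, by omega⟩ := by
      intro i h hi
      have hq : Q ⟨i, by omega⟩ := ⟨h, hi⟩
      have hp : ¬ P ⟨i, by omega⟩ := by
        rintro ⟨j, hj, hij, hj'⟩
        dsimp only at hij
        subst hij
        have := hred j h (by rw [hi, hj'])
        simp [hi, hj'] at this
      exact ⟨hq, by simp [f, hp, hq]⟩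
    have hinj : Set.InjOn f (Finset.univ.filter fun j ↦ P j ∨ Q j : Finset (Fin (n + 1))) := by
      have hPQ : ∀ i j (hi : i < L.length) (hj : j < L.length), L[i] = (a, true) →
          L[j] = (a, false) → i ≠ j + 1 := by
        rintro i j hi hj hia hja rfl
        have := hred j hi (by rw [hia, hja])
        simp [hia, hja] at this
      intro j hj k hk hjk
      simp only [Finset.coe_filter, Finset.mem_univ, true_and, Set.mem_ofPred_eq] at hj hk
      obtain ⟨j, hj'⟩ := j
      obtain ⟨k, hk'⟩ := k
      rcases hj with ⟨i, hi, rfl, hia⟩ | ⟨hi, hia⟩ <;>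
        rcases hk with ⟨l, hl, rfl, hla⟩ | ⟨hl, hla⟩
      · rw [(hP i hi hia).2, (hP l hl hla).2] at hjk
        simpa using hjk
      · rw [(hP i hi hia).2, (hQ k hl hla).2] at hjk
        exact absurd (by simpa using hjk) (hPQ i k hi hl hia hla)
      · rw [(hQ j hi hia).2, (hP l hl hla).2] at hjk
        exact absurd (by simpa using hjk.symm) (hPQ l j hl hi hla hia)
      · rw [(hQ j hi hia).2, (hQ k hl hla).2] at hjk
        simpa using hjk
    obtain ⟨e, he⟩ := Finset.exists_equiv_extend_of_card_eq (t := Finset.univ) (by simp)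
      (Finset.subset_univ _) hinj
    refine ⟨e.trans (Equiv.subtypeUnivEquiv (by simp)), fun i h ↦ ⟨fun hi ↦ ?_, fun hi ↦ ?_⟩⟩
    · have := he ⟨i + 1, by omega⟩ (by simpa using Or.inl (hP i h hi).1)
      simpa [(hP i h hi).2] using this
    · have := he ⟨i, by omega⟩ (by simpa using Or.inr (hQ i h hi).1)
      simpa [(hQ i h hi).2] using this
  choose σ hσ using key
  refine ⟨n + 1, σ, fun h ↦ ?_⟩
  have hmove : ∀ m (hm : m ≤ n),
      FreeGroup.lift σ (FreeGroup.mk (L.take m)) ⟨m, by omega⟩ = ⟨0, by omega⟩ := by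
    intro m
    induction m with
    | zero => intro _; simp [← FreeGroup.one_eq_mk]
    | succ m ih =>
      intro hm
      have hm' : m < L.length := by omega
      rw [List.take_add_one, List.getElem?_eq_getElem hm', Option.toList_some,
        ← FreeGroup.mul_mk, _root_.map_mul, Equiv.Perm.mul_apply, ← ih (by omega)]
      congr 1
      rcases hl : L[m] with ⟨a, b⟩
      have := hσ a m hm'
      cases b
      · simpa [FreeGroup.lift_mk, Equiv.symm_apply_eq] using (this.2 hl).symm
      · simpa [FreeGroup.lift_mk] using this.1 hl
  have := hmove n le_rfl
  rw [show L.take n = g.toWord from List.take_length, FreeGroup.mk_toWord, h] at this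
  simp at this
  omega

/-- A surjection from a free group of finite rank onto a free group of at least the same rank is
injective. -/
theorem FreeGroup.injective_of_surjective {α β : Type*} [Finite α] (ι : α ↪ β)
    (φ : FreeGroup α →* FreeGroup β) (hφ : Function.Surjective φ) : Function.Injective φ := by
  rw [injective_iff_map_eq_one]
  intro g hg
  by_contra hne
  obtain ⟨n, σ, hσ⟩ := FreeGroup.exists_lift_perm_ne_one hne
  let F : (β → Equiv.Perm (Fin n)) → (α → Equiv.Perm (Fin n)) :=
    fun τ ↦ FreeGroup.lift.symm ((FreeGroup.lift τ).comp φ)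
  have hF : Function.Injective F := fun τ₁ τ₂ h ↦
    FreeGroup.lift.injective ((MonoidHom.cancel_right hφ).1 (FreeGroup.lift.symm.injective h))
  have hext : Function.Injective
      fun τ : α → Equiv.Perm (Fin n) ↦ Function.extend ι τ (1 : β → Equiv.Perm (Fin n)) :=
    Function.extend_injective ι.injective _
  obtain ⟨τ, rfl⟩ := (Finite.surjective_of_injective (hF.comp hext)).of_comp σ
  exact hσ (by simp [F, hg])

theorem range_le_of_closure {G G' : Type*} [Group G] [Group G'] {S : Set G} {K : Subgroup G'}
    {f : Subgroup.closure S →* G'}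
    (h : ∀ s (hs : s ∈ S), f ⟨s, Subgroup.subset_closure hs⟩ ∈ K) : f.range ≤ K := by
  rw [MonoidHom.range_eq_map, ← Subgroup.closure_closure_coe_preimage, MonoidHom.map_closure,
    Subgroup.closure_le]
  rintro _ ⟨s, hs, rfl⟩
  exact h s hs

theorem exists_closure_eq_encard_eq_grpRank {G : Type*} [Group G] (H : Subgroup G) :
    ∃ S : Set G, Subgroup.closure S = H ∧ S.encard = grpRank H := by
  have : Nonempty {S : Set G | Subgroup.closure S = H} := ⟨⟨H, Subgroup.closure_eq H⟩⟩
  obtain ⟨S, hS⟩ := ENat.exists_eq_iInf fun S : {S : Set G | Subgroup.closure S = H} ↦ S.1.encard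
  exact ⟨S, S.2, by rw [hS, grpRank, iInf_subtype']⟩

theorem grpRank_closure_le {G : Type*} [Group G] (S : Set G) :
    grpRank (Subgroup.closure S) ≤ S.encard :=
  iInf₂_le (f := fun (T : Set G) (_ : Subgroup.closure T = Subgroup.closure S) ↦ T.encard) S rfl

theorem grpRank_le_card_generators {G : Type*} [Group G] (H : Subgroup G) [IsFreeGroup H] :
    grpRank H ≤ ENat.card (IsFreeGroup.Generators H) := by
  have hcl : Subgroup.closure (range fun y ↦ (IsFreeGroup.of y : H)) = ⊤ := by
    have := congrArg (Subgroup.map (IsFreeGroup.mulEquiv H).toMonoidHom)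
      (FreeGroup.closure_range_of (IsFreeGroup.Generators H))
    rw [MonoidHom.map_closure, ← range_comp, ← MonoidHom.range_eq_map,
      MonoidHom.range_eq_top.2 (IsFreeGroup.mulEquiv H).surjective] at this
    exact this
  have hcl' : Subgroup.closure (range fun y ↦ ((IsFreeGroup.of y : H) : G)) = H := by
    have := congrArg (Subgroup.map H.subtype) hcl
    rw [MonoidHom.map_closure, ← range_comp, ← MonoidHom.range_eq_map, H.range_subtype] at this
    exact this
  calc grpRank H = _ := by rw [hcl']
    _ ≤ _ := grpRank_closure_le _
    _ ≤ _ := by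
      rw [← image_univ, ← encard_univ]
      exact encard_image_le _ _

/-- In a `k`-free group, if `A` is a subgroup of rank `r` (`1 ≤ r ≤ k-1`) and
`x` is an element such that `⟨A, x⟩` has rank `r + 1`, then `⟨A, x⟩ = A ∗ ⟨x⟩` internally:
the natural homomorphism `A ∗ ⟨x⟩ →* Γ` induced by the inclusions is injective with image
`⟨A, x⟩`. -/
theorem statement6 {Γ : Type*} [Group Γ] (k : ℕ) (hk : 2 ≤ k) (hΓ : KFree Γ k)
    (r : ℕ) (hr1 : 1 ≤ r) (hrk : r ≤ k - 1) (A : Subgroup Γ) (hA : grpRank A = (r : ℕ∞))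
    (x : Γ) (hx : grpRank (A ⊔ Subgroup.closure {x}) = (r : ℕ∞) + 1) :
    Function.Injective (Monoid.Coprod.lift A.subtype (Subgroup.closure {x}).subtype) ∧
      (Monoid.Coprod.lift A.subtype (Subgroup.closure {x}).subtype).range =
        A ⊔ Subgroup.closure {x} := by
  set L := Monoid.Coprod.lift A.subtype (Subgroup.closure {x}).subtype with hL
  have hrange : L.range = A ⊔ Subgroup.closure {x} := by
    rw [hL, Monoid.Coprod.range_lift, Subgroup.range_subtype, Subgroup.range_subtype]
  refine ⟨?_, hrange⟩
  rw [← hrange] at hx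
  have : IsFreeGroup L.range := hΓ _ (by rw [hx]; norm_cast; omega)
  obtain ⟨S, rfl, hS⟩ := exists_closure_eq_encard_eq_grpRank A
  rw [hA] at hS
  have hfin : Finite S := finite_of_encard_eq_coe hS
  obtain ⟨ι⟩ : Nonempty (Option S ↪ IsFreeGroup.Generators L.range) := by
    have hle := hx ▸ grpRank_le_card_generators L.range
    have hmk : Cardinal.mk S = r := Cardinal.toENat_eq_natCast.1 hS
    rw [← Cardinal.le_def, Cardinal.mk_option, hmk]
    exact_mod_cast (Cardinal.natCast_le_toENat (n := r + 1)).1 (by exact_mod_cast hle)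
  let ψ : FreeGroup (Option S) →* Monoid.Coprod (Subgroup.closure S) (Subgroup.closure {x}) :=
    FreeGroup.lift fun o ↦ o.elim (Monoid.Coprod.inr ⟨x, Subgroup.subset_closure rfl⟩)
      fun s ↦ Monoid.Coprod.inl ⟨s, Subgroup.subset_closure s.2⟩
  have hψ : Function.Surjective ψ := by
    rw [← MonoidHom.range_eq_top, eq_top_iff, ← Monoid.Coprod.range_inl_sup_range_inr]
    refine sup_le (range_le_of_closure fun s hs ↦ ?_) (range_le_of_closure fun s hs ↦ ?_)
    · exact ⟨FreeGroup.of (some ⟨s, hs⟩), by simp [ψ]⟩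
    · obtain rfl : s = x := hs
      exact ⟨FreeGroup.of none, by simp [ψ]⟩
  have hinj := FreeGroup.injective_of_surjective ι
    ((IsFreeGroup.toFreeGroup L.range).toMonoidHom.comp (L.rangeRestrict.comp ψ))
    ((IsFreeGroup.toFreeGroup L.range).surjective.comp (L.rangeRestrict_surjective.comp hψ))
  rw [injective_iff_map_eq_one] at hinj ⊢
  intro w hw
  obtain ⟨u, rfl⟩ := hψ w
  have hu : L.rangeRestrict (ψ u) = 1 := Subtype.ext hw
  rw [hinj u (by simp [hu]), map_one]
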